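/- arXiv:2005.13226 — 7 statements merged into one kernel-verified Lean document; each statement's English description precedes it below -/
import Mathlib

section
/- Let C be a C*-algebra, let 𝒜 and ℬ be subsets of C such that every element of 𝒜 commutes with every element of ℬ, and let n be a natural number. If a = (a_{ij}) is a positive element of the C*-algebra M_n(C) of n×n matrices over C all of whose entries a_{ij} lie in 𝒜, and b = (b_{ij}) is a positive element of M_n(C) all of whose entries b_{ij} lie in ℬ, then the Schur (entrywise) product c := (a_{ij} b_{ij}) is a positive element of M_n(C). -/
open scoped Matrix

/-!
STATEMENT 0: Let `C` be a C*-algebra, `𝒜, ℬ ⊆ C` with every element of `𝒜` commuting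
with every element of `ℬ`.  If `a`, `b` are positive elements of the C*-algebra
`M_n(C)` with entries in `𝒜` resp. `ℬ`, then the Schur (entrywise) product
`c := (a_{ij} b_{ij})` is positive in `M_n(C)`.

This Mathlib version has no C*-norm on matrices over a general C*-algebra, so we encode
positivity in the C*-algebra `M_n(C)` via its standard equivalent characterization:
an element of a C*-algebra is positive iff it is of the form `xᴴ * x` (`star x * x`).
-/

/-- Positivity in the C*-algebra `M_n(C)`: an element is positive iff it is of the form
`xᴴ * x` for some matrix `x`. -/
def MatrixIsPositive {C : Type*} [CStarAlgebra C]
    {n : ℕ} (a : Matrix (Fin n) (Fin n) C) : Prop :=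
  ∃ x : Matrix (Fin n) (Fin n) C, a = xᴴ * x

/-- A positive element of a C⋆-algebra is of the form `star s * s` with `s` in its bicommutant. -/
lemma CStarAlgebra.exists_eq_star_mul_self_of_nonneg {A : Type*} [NonUnitalCStarAlgebra A]
    [PartialOrder A] [StarOrderedRing A] {a : A} (ha : 0 ≤ a) :
    ∃ s, a = star s * s ∧ ∀ d, Commute a d → Commute s d :=
  ⟨CFC.sqrt a, by rw [(CFC.sqrt_nonneg a).isSelfAdjoint.star_eq, CFC.sqrt_mul_sqrt_self a ha],
    fun _ hd => hd.cfcₙ_nnreal NNReal.sqrt⟩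

namespace CStarMatrix

variable {n A : Type*} [Fintype n] [CStarAlgebra A] [PartialOrder A] [StarOrderedRing A]

/-- A positive matrix is of the form `star s * s`, where the entries of `s` commute with everything
that commutes with the entries of the matrix. -/
lemma exists_eq_star_mul_self_of_nonneg {a : CStarMatrix n n A} (ha : 0 ≤ a) :
    ∃ s : CStarMatrix n n A, a = star s * s ∧
      ∀ d, (∀ i j, Commute (a i j) d) → ∀ i j, Commute (s i j) d := by
  classical
  obtain ⟨s, hs, hcomm⟩ := CStarAlgebra.exists_eq_star_mul_self_of_nonneg ha
  refine ⟨s, hs, fun d hd => ?_⟩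
  let D : CStarMatrix n n A := ofMatrix (Matrix.diagonal fun _ => d)
  have commute_diagonal (M : CStarMatrix n n A) :
      Commute M D ↔ ∀ i j, Commute (M i j) d := by
    have hr (i j) : (M * D) i j = M i j * d := Matrix.mul_diagonal _ M i j
    have hl (i j) : (D * M) i j = d * M i j := Matrix.diagonal_mul _ M i j
    simp only [commute_iff_eq, ← CStarMatrix.ext_iff, hr, hl]
  exact (commute_diagonal s).1 (hcomm D ((commute_diagonal a).2 hd))

/-- If the entries of `x` commute with those of `b ≥ 0`, then the entrywise product of `star x * x`
with `b` is positive, being a sum of conjugates of `b` by diagonal matrices. -/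
lemma entrywise_star_mul_self_mul_nonneg (x b : CStarMatrix n n A) (hb : 0 ≤ b)
    (h : ∀ i j k l, Commute (x i j) (b k l)) :
    0 ≤ (ofMatrix (Matrix.of fun i j => (star x * x) i j * b i j) : CStarMatrix n n A) := by
  classical
  let D (k : n) : CStarMatrix n n A := ofMatrix (Matrix.diagonal (x k))
  have hsum : (ofMatrix (Matrix.of fun i j => (star x * x) i j * b i j) : CStarMatrix n n A)
      = ∑ k, star (D k) * b * D k := by
    have hconj (k i j) : (star (D k) * b * D k) i j = star (x k i) * b i j * x k j := by
      have hD : star (D k) = ofMatrix (Matrix.diagonal (star (x k))) :=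
        Matrix.diagonal_conjTranspose (x k)
      rw [hD]
      exact (Matrix.mul_diagonal _ _ i j).trans
        (congrArg (· * x k j) (Matrix.diagonal_mul _ b i j))
    ext i j
    calc (star x * x) i j * b i j = (∑ k, star (x k i) * x k j) * b i j := rfl
      _ = ∑ k, (star (D k) * b * D k) i j := by
        simp only [Finset.sum_mul, hconj, mul_assoc, (h _ _ _ _).eq]
      _ = _ := (Matrix.sum_apply i j Finset.univ fun k => star (D k) * b * D k).symm
  rw [hsum]
  exact Finset.sum_nonneg fun k _ => star_left_conjugate_nonneg hb (D k)

end CStarMatrix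

theorem schur_product_positive_of_commuting_entries
    {C : Type*} [CStarAlgebra C]
    (𝒜 ℬ : Set C) (hcomm : ∀ a ∈ 𝒜, ∀ b ∈ ℬ, Commute a b)
    (n : ℕ) (a b : Matrix (Fin n) (Fin n) C)
    (haA : ∀ i j, a i j ∈ 𝒜) (hbB : ∀ i j, b i j ∈ ℬ)
    (ha : MatrixIsPositive a) (hb : MatrixIsPositive b) :
    MatrixIsPositive (Matrix.of fun i j => a i j * b i j) := by
  let : PartialOrder C := CStarAlgebra.spectralOrder C
  have : StarOrderedRing C := CStarAlgebra.spectralOrderedRing C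
  have nonneg_of_positive {M : Matrix (Fin n) (Fin n) C} (hM : MatrixIsPositive M) :
      0 ≤ CStarMatrix.ofMatrix M := by
    obtain ⟨x, rfl⟩ := hM
    exact star_mul_self_nonneg (CStarMatrix.ofMatrix x)
  obtain ⟨s, hs, hcomm_s⟩ := CStarMatrix.exists_eq_star_mul_self_of_nonneg (nonneg_of_positive ha)
  have hc := CStarMatrix.entrywise_star_mul_self_mul_nonneg s _ (nonneg_of_positive hb)
    fun i j k l => hcomm_s (b k l) (fun p q => hcomm _ (haA p q) _ (hbB k l)) i j
  rw [← hs] at hc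
  obtain ⟨z, hz, -⟩ := CStarMatrix.exists_eq_star_mul_self_of_nonneg hc
  exact ⟨CStarMatrix.ofMatrix.symm z, hz⟩
end

section
/- Let G be a countable group and let (B_n)_{n ∈ ℕ} be a sequence of finite nonempty subsets of G. Then there exist a strictly increasing function φ : ℕ → ℕ and a function χ : G → ℝ such that for every g ∈ G the sequence χ_{B_{φ(j)}}(g) = |B_{φ(j)} ∩ g·B_{φ(j)}| / |B_{φ(j)}| converges to χ(g) as j → ∞; moreover χ is positive definite, χ(1) = 1, and 0 ≤ χ(g) ≤ 1 for every g ∈ G. -/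
open scoped Pointwise

/-- For a finite nonempty subset `S` of a group `G`, `χ_S(g) := |S ∩ gS| / |S|`. -/
noncomputable def chiS {G : Type*} [Group G] [DecidableEq G] (S : Finset G) (g : G) : ℝ :=
  ((S ∩ g • S).card : ℝ) / S.card

theorem chiS_nonneg {G : Type*} [Group G] [DecidableEq G] (S : Finset G) (g : G) :
    0 ≤ chiS S g := by
  unfold chiS
  positivity

theorem chiS_le_one {G : Type*} [Group G] [DecidableEq G] (S : Finset G) (g : G) :
    chiS S g ≤ 1 :=
  div_le_one_of_le₀ (by exact_mod_cast Finset.card_le_card Finset.inter_subset_left)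
    (Nat.cast_nonneg _)

theorem chiS_one {G : Type*} [Group G] [DecidableEq G] {S : Finset G} (hS : S.Nonempty) :
    chiS S 1 = 1 := by
  simp [chiS, hS.ne_empty]

theorem chiS_inv_mul {G : Type*} [Group G] [DecidableEq G] (S : Finset G) (g h : G) :
    chiS S (g⁻¹ * h) = (S.card : ℝ)⁻¹ * ((g • S ∩ h • S).card : ℝ) := by
  have key : g • (S ∩ (g⁻¹ * h) • S) = g • S ∩ h • S := by
    rw [Finset.smul_finset_inter, smul_smul, mul_inv_cancel_left]
  rw [chiS, ← key, Finset.card_smul_finset, div_eq_inv_mul]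

theorem Matrix.PosSemidef.of_card_inter {ι α : Type*} [Fintype ι] [DecidableEq α]
    (s : ι → Finset α) :
    Matrix.PosSemidef (Matrix.of fun i j => ((s i ∩ s j).card : ℝ)) := by
  let T : Finset α := Finset.univ.biUnion s
  let A : Matrix ι T ℝ := Matrix.of fun i x => if (x : α) ∈ s i then 1 else 0
  convert Matrix.posSemidef_self_mul_conjTranspose A using 1
  ext i j
  have hsub : s i ∩ s j = T.filter fun x => x ∈ s j ∧ x ∈ s i := by
    ext x
    simp only [Finset.mem_inter, Finset.mem_filter, T, Finset.mem_biUnion, Finset.mem_univ,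
      true_and]
    exact ⟨fun h => ⟨⟨i, h.1⟩, h.2, h.1⟩, fun h => ⟨h.2.2, h.2.1⟩⟩
  simp only [Matrix.mul_apply, Matrix.of_apply, Matrix.conjTranspose_apply, A, star_trivial,
    mul_ite, mul_one, mul_zero, ← ite_and]
  rw [Finset.sum_coe_sort T fun x => if x ∈ s j ∧ x ∈ s i then (1 : ℝ) else 0,
    Finset.sum_boole, hsub]

theorem posSemidef_chiS {G ι : Type*} [Group G] [DecidableEq G] [Fintype ι] (S : Finset G)
    (g : ι → G) : Matrix.PosSemidef (Matrix.of fun i j => chiS S ((g i)⁻¹ * g j)) := by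
  convert (Matrix.PosSemidef.of_card_inter fun i => g i • S).smul
    (inv_nonneg.2 (Nat.cast_nonneg (α := ℝ) S.card)) using 1
  ext i j
  simp [chiS_inv_mul]

theorem Matrix.PosSemidef.of_tendsto {ι κ : Type*} {l : Filter κ} [l.NeBot]
    {M : κ → Matrix ι ι ℝ} {N : Matrix ι ι ℝ} (hM : ∀ k, (M k).PosSemidef)
    (h : ∀ i j, Filter.Tendsto (fun k => M k i j) l (nhds (N i j))) : N.PosSemidef := by
  refine ⟨Matrix.IsHermitian.ext fun i j => ?_, fun x => ?_⟩
  · refine tendsto_nhds_unique (h j i) ((h i j).congr fun k => ?_)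
    exact ((hM k).isHermitian.apply j i)
  · refine ge_of_tendsto' (f := fun k => x.sum fun i xi => x.sum fun j xj =>
      star xi * M k i j * xj) (x := l) ?_ fun k => (hM k).2 x
    exact tendsto_finsetSum _ fun i _ => tendsto_finsetSum _ fun j _ =>
      ((h i j).const_mul _).mul_const _

/-- for a countable group `G` and a sequence of finite nonempty subsets
`B_n`, some subsequence of `χ_{B_n}` converges pointwise to a positive definite function
`χ` with `χ(1) = 1` and `0 ≤ χ(g) ≤ 1` for every `g`. -/
theorem exists_subseq_chiS_tendsto_posDef {G : Type*} [Group G] [DecidableEq G]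
    [Countable G] (B : ℕ → Finset G) (hB : ∀ n, (B n).Nonempty) :
    ∃ (φ : ℕ → ℕ) (χ : G → ℝ), StrictMono φ ∧
      (∀ g : G,
        Filter.Tendsto (fun j => chiS (B (φ j)) g) Filter.atTop (nhds (χ g))) ∧
      (∀ (n : ℕ) (g : Fin n → G),
        Matrix.PosSemidef (Matrix.of fun i j => χ ((g i)⁻¹ * g j))) ∧
      χ 1 = 1 ∧ ∀ g : G, 0 ≤ χ g ∧ χ g ≤ 1 := by
  obtain ⟨χ, hχ, φ, hφ, hlim⟩ :=
    (isCompact_univ_pi fun _ : G => isCompact_Icc (a := (0 : ℝ)) (b := 1)).tendsto_subseq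
      (x := fun n => chiS (B n)) fun n g _ => ⟨chiS_nonneg _ g, chiS_le_one _ g⟩
  have hpt : ∀ g : G,
      Filter.Tendsto (fun j => chiS (B (φ j)) g) Filter.atTop (nhds (χ g)) :=
    tendsto_pi_nhds.1 hlim
  refine ⟨φ, χ, hφ, hpt, fun n g => ?_, ?_, fun g => hχ g trivial⟩
  · exact .of_tendsto (fun j => posSemidef_chiS (B (φ j)) g) fun i j => hpt _
  · exact tendsto_nhds_unique (hpt 1)
      (tendsto_const_nhds.congr fun j => (chiS_one (hB (φ j))).symm)
end

section
/- Let k ≥ 2, let F_k be the free group on k generators, let t ∈ F_k with word length ℓ := ℓ(t) ≥ 1, let i be a natural number with i ≤ ℓ − 1, and let n be a natural number with n ≥ 2ℓ. Then the number of elements h ∈ F_k with ℓ(h) = n − i and ℓ(t·h) ≤ n equals (2k−1)^{n − ℓ + ⌊(ℓ−i)/2⌋}. -/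
namespace FreeGroup

variable {α : Type*}

theorem _root_.List.exists_maximal_common_prefix (u w : List α) :
    ∃ p q r : List α, u = p ++ q ∧ w = p ++ r ∧ ∀ a ∈ q.head?, ∀ b ∈ r.head?, a ≠ b := by
  induction u generalizing w with
  | nil => exact ⟨[], [], w, by simp⟩
  | cons a u ih =>
    cases w with
    | nil => exact ⟨[], a :: u, [], by simp⟩
    | cons b w =>
      by_cases hab : a = b
      · subst hab
        obtain ⟨p, q, r, rfl, rfl, h⟩ := ih w
        exact ⟨a :: p, q, r, rfl, rfl, h⟩
      · exact ⟨[], a :: u, b :: w, by simpa using hab⟩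

theorem IsReduced.invRev [DecidableEq α] {L : List (α × Bool)} (h : IsReduced L) :
    IsReduced (invRev L) := by
  rw [isReduced_iff_reduce_eq, reduce_invRev, h.reduce_eq]

theorem IsReduced.invRev_append [DecidableEq α] {q r : List (α × Bool)} (hq : IsReduced q)
    (hr : IsReduced r) (hne : ∀ a ∈ q.head?, ∀ b ∈ r.head?, a ≠ b) :
    IsReduced (FreeGroup.invRev q ++ r) := by
  refine List.isChain_append.2 ⟨hq.invRev, hr, ?_⟩
  intro x hx y hy hxy
  simp only [FreeGroup.invRev, List.getLast?_reverse, List.head?_map, Option.mem_def,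
    Option.map_eq_some_iff] at hx
  obtain ⟨a, ha, rfl⟩ := hx
  have := hne a ha y hy
  rcases a with ⟨a, _ | _⟩ <;> rcases y with ⟨y, _ | _⟩ <;> simp_all

theorem mul_eq_mk_invRev_append [DecidableEq α] {t h : FreeGroup α} {p q r : List (α × Bool)}
    (hu : t⁻¹.toWord = p ++ q) (hw : h.toWord = p ++ r) : t * h = mk (invRev q ++ r) := by
  have ht : t = (mk p * mk q)⁻¹ := by
    rw [mul_mk, ← hu, mk_toWord, inv_inv]
  have hh : h = mk p * mk r := by
    rw [mul_mk, ← hw, mk_toWord]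
  rw [ht, hh, ← mul_mk, ← inv_mk]
  group

/-- The product `t * h` cancels a common prefix of the reduced words of `t⁻¹` and `h`, and each
cancelled letter lowers the norm by two. -/
theorem exists_norm_mul_add_two_mul_eq [DecidableEq α] (t h : FreeGroup α) :
    ∃ c, (t * h).norm + 2 * c = t.norm + h.norm ∧ t⁻¹.toWord.take c <+: h.toWord := by
  obtain ⟨p, q, r, hu, hw, hne⟩ := List.exists_maximal_common_prefix t⁻¹.toWord h.toWord
  have hq : IsReduced q := (hu ▸ isReduced_toWord).infix (List.suffix_append p q).isInfix
  have hr : IsReduced r := (hw ▸ isReduced_toWord).infix (List.suffix_append p r).isInfix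
  refine ⟨p.length, ?_, ?_⟩
  · rw [mul_eq_mk_invRev_append hu hw, ← norm_inv_eq (x := t), norm, norm, norm, toWord_mk,
      (hq.invRev_append hr hne).reduce_eq, hu, hw]
    simp only [List.length_append, invRev_length]
    omega
  · rw [hu, hw, List.take_left]
    exact List.prefix_append p r

/-- Multiplying on the left by `t` cancels at least `m` letters of `h` exactly when the reduced
word of `h` starts with the first `m` letters of `t⁻¹`. -/
theorem norm_mul_add_two_mul_le_iff [DecidableEq α] (t h : FreeGroup α) {m : ℕ}
    (hm : m ≤ t.norm) :
    (t * h).norm + 2 * m ≤ t.norm + h.norm ↔ t⁻¹.toWord.take m <+: h.toWord := by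
  constructor
  · intro hle
    obtain ⟨c, hc, hpre⟩ := exists_norm_mul_add_two_mul_eq t h
    exact (List.take_prefix_take_left (by omega)).trans hpre
  · rintro ⟨r, hr⟩
    have hnorm : t.norm = t⁻¹.toWord.length := norm_inv_eq.symm
    have hmul := norm_mk_le (L₁ := invRev (t⁻¹.toWord.drop m) ++ r)
    rw [← mul_eq_mk_invRev_append (List.take_append_drop m _).symm hr.symm] at hmul
    have hlen : _ = h.norm := congrArg List.length hr
    simp only [List.length_append, List.length_take, List.length_drop, invRev_length] at hmul hlen
    omega

theorem isReduced_append_singleton_append {p r : List (α × Bool)} {a : α × Bool}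
    (hp : IsReduced (p ++ [a])) : IsReduced (p ++ [a] ++ r) ↔ IsReduced (a :: r) :=
  ⟨fun h ↦ h.infix ⟨p, [], by simp⟩, fun h ↦ hp.append_overlap (L₃ := r) h (by simp)⟩

theorem exists_finset_isReduced_cons [Fintype α] [DecidableEq α] (r : ℕ) (a : α × Bool) :
    ∃ F : Finset (List (α × Bool)),
      (∀ L, L ∈ F ↔ L.length = r ∧ IsReduced (a :: L)) ∧
        F.card = (2 * Fintype.card α - 1) ^ r := by
  induction r generalizing a with
  | zero =>
    refine ⟨{[]}, fun L ↦ ?_, by simp⟩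
    rw [Finset.mem_singleton, List.length_eq_zero_iff]
    exact ⟨fun h ↦ ⟨h, h ▸ IsReduced.singleton⟩, fun h ↦ h.1⟩
  | succ r ih =>
    choose F hF hcard using ih
    refine ⟨(Finset.univ.erase (a.1, !a.2)).biUnion fun b ↦ (F b).image (List.cons b), ?_, ?_⟩
    · rintro (_ | ⟨b, L⟩)
      · simp
      · have hab : b ≠ (a.1, !a.2) ↔ (a.1 = b.1 → a.2 = b.2) := by
          rcases a with ⟨a, _ | _⟩ <;> rcases b with ⟨b, _ | _⟩ <;> simp [eq_comm]
        simp [hF, ← hab]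
        tauto
    · rw [Finset.card_biUnion]
      · simp_rw [Finset.card_image_of_injective _ List.cons_injective, hcard]
        rw [Finset.sum_const, Finset.card_erase_of_mem (Finset.mem_univ _), Finset.card_univ,
          Fintype.card_prod, Fintype.card_bool, smul_eq_mul, pow_succ', mul_comm 2]
      · intro b _ c _ hbc
        simp only [Function.onFun, Finset.disjoint_left, Finset.mem_image]
        rintro _ ⟨L, _, rfl⟩ ⟨L', _, h⟩
        exact hbc (List.cons.inj h).1.symm

/-- The number of elements of a free group of norm `p.length + r` whose reduced word starts with a
given nonempty reduced word `p`. -/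
theorem finite_and_ncard_prefix [Fintype α] [DecidableEq α] {p : List (α × Bool)}
    (hp : IsReduced p) (hne : p ≠ []) (r : ℕ) :
    {h : FreeGroup α | h.norm = p.length + r ∧ p <+: h.toWord}.Finite ∧
      {h : FreeGroup α | h.norm = p.length + r ∧ p <+: h.toWord}.ncard =
        (2 * Fintype.card α - 1) ^ r := by
  obtain ⟨p', a, rfl⟩ := List.eq_nil_or_concat' p |>.resolve_left hne
  obtain ⟨F, hF, hcard⟩ := exists_finset_isReduced_cons r a
  have hword {L} (hL : L ∈ F) : (mk (p' ++ [a] ++ L)).toWord = p' ++ [a] ++ L := by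
    rw [toWord_mk, ((isReduced_append_singleton_append hp).2 ((hF L).1 hL).2).reduce_eq]
  have hset : {h : FreeGroup α | h.norm = (p' ++ [a]).length + r ∧ p' ++ [a] <+: h.toWord} =
      (fun L ↦ mk (p' ++ [a] ++ L)) '' (F : Set (List (α × Bool))) := by
    ext h
    constructor
    · rintro ⟨hn, L, hL⟩
      refine ⟨L, (hF L).2 ⟨?_, ?_⟩, by simp only [hL, mk_toWord]⟩
      · rw [norm, ← hL, List.length_append] at hn
        omega
      · exact (isReduced_append_singleton_append hp).1 (hL ▸ isReduced_toWord)
    · rintro ⟨L, hL, rfl⟩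
      refine ⟨?_, ?_⟩
      · simp only [norm, hword hL]
        rw [List.length_append, ((hF L).1 hL).1]
      · simp only [hword hL]
        exact List.prefix_append _ _
  rw [hset]
  refine ⟨F.finite_toSet.image _, ?_⟩
  rw [Set.InjOn.ncard_image, Set.ncard_coe_finset, hcard]
  intro L hL L' hL' h
  have := congrArg toWord h
  simp only [hword hL, hword hL'] at this
  exact List.append_cancel_left this

end FreeGroup


/-- in the free group on `k ≥ 2` generators, for `t` of word length
`ℓ ≥ 1`, `i ≤ ℓ − 1` and `n ≥ 2ℓ`, the number of elements `h` with `ℓ(h) = n − i` and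
`ℓ(t·h) ≤ n` equals `(2k−1)^{n − ℓ + ⌊(ℓ−i)/2⌋}`. -/
theorem card_sphere_inter_translate_ball_freeGroup (k : ℕ) (hk : 2 ≤ k)
    (t : FreeGroup (Fin k)) (ℓ i n : ℕ) (hℓ : t.norm = ℓ) (hℓ1 : 1 ≤ ℓ)
    (hi : i ≤ ℓ - 1) (hn : 2 * ℓ ≤ n) :
    {h : FreeGroup (Fin k) | h.norm = n - i ∧ (t * h).norm ≤ n}.Finite ∧
      Nat.card {h : FreeGroup (Fin k) | h.norm = n - i ∧ (t * h).norm ≤ n} =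
        (2 * k - 1) ^ (n - ℓ + (ℓ - i) / 2) := by
  obtain ⟨m, hm⟩ : ∃ m, m = (ℓ - i + 1) / 2 := ⟨_, rfl⟩
  have hlen : (t⁻¹.toWord.take m).length = m := by
    have : t⁻¹.toWord.length = ℓ := FreeGroup.norm_inv_eq.trans hℓ
    rw [List.length_take]
    omega
  have hset : {h : FreeGroup (Fin k) | h.norm = n - i ∧ (t * h).norm ≤ n} =
      {h | h.norm = (t⁻¹.toWord.take m).length + (n - ℓ + (ℓ - i) / 2) ∧
        t⁻¹.toWord.take m <+: h.toWord} := by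
    ext h
    rw [Set.mem_ofPred_eq, Set.mem_ofPred_eq,
      ← FreeGroup.norm_mul_add_two_mul_le_iff t h (by omega), hlen]
    obtain ⟨c, hc, -⟩ := FreeGroup.exists_norm_mul_add_two_mul_eq t h
    omega
  have hred : FreeGroup.IsReduced (t⁻¹.toWord.take m) :=
    FreeGroup.isReduced_toWord.infix (List.take_prefix m _).isInfix
  have hne : t⁻¹.toWord.take m ≠ [] := by
    rw [← List.length_pos_iff]
    omega
  rw [hset, Nat.card_coe_set_eq]
  simpa using FreeGroup.finite_and_ncard_prefix hred hne (n - ℓ + (ℓ - i) / 2)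
end

section
/- Let k ≥ 2, let F_k be the free group on k generators, and set q := 2k − 1. Let t ∈ F_k have even word length ℓ(t) = 2m for some m ∈ ℕ, and let n ≥ 4m. Then the set T_n(t) := {h ∈ F_k : ℓ(h) ≤ n and ℓ(t·h) ≤ n} is finite and satisfies (q − 1) · |T_n(t)| = q^{n−m+1} + q^{n−m} − 2. -/
theorem List.pairwiseDisjoint_map_cons {α : Type*} (s : Set α) (f : α → Finset (List α)) :
    s.PairwiseDisjoint fun y => (f y).map ⟨List.cons y, List.cons_injective⟩ := by
  intro y _ z _ hyz
  simp only [Function.onFun, Finset.disjoint_left, Finset.mem_map]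
  rintro _ ⟨l, _, rfl⟩ ⟨l', _, h⟩
  exact hyz (List.cons.inj h).1.symm

/-- If every element has exactly `d` successors for `r`, the `r`-chains following `x` with at most
`n` entries are counted by a geometric sum. -/
theorem List.exists_finset_isChain_cons_length_le {α : Type*} [Fintype α] [DecidableEq α]
    (r : α → α → Prop) [DecidableRel r] (d : ℕ)
    (hd : ∀ x, (Finset.univ.filter (r x)).card = d) (n : ℕ) (x : α) :
    ∃ s : Finset (List α), (∀ l, l ∈ s ↔ (x :: l).IsChain r ∧ l.length ≤ n) ∧
      s.card = ∑ i ∈ Finset.range (n + 1), d ^ i := by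
  induction n generalizing x with
  | zero =>
    refine ⟨{[]}, fun l => ?_, by simp⟩
    cases l <;> simp
  | succ n ih =>
    choose f hf hcard using ih
    refine ⟨insert [] ((Finset.univ.filter (r x)).disjiUnion
      (fun y => (f y).map ⟨List.cons y, List.cons_injective⟩)
      (List.pairwiseDisjoint_map_cons _ f)), fun l => ?_, ?_⟩
    · cases l with
      | nil => simp
      | cons y l => simp [hf, and_assoc]
    · rw [Finset.card_insert_of_notMem (by simp), Finset.card_disjiUnion]
      simp only [Finset.card_map, hcard, Finset.sum_const, hd, smul_eq_mul]
      rw [geom_sum_succ (n := n + 1)]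

/-- If every element has exactly `d` successors for `r`, the nonempty `r`-chains with at most
`n` entries are counted by a geometric sum. -/
theorem List.exists_finset_isChain_length_le {α : Type*} [Fintype α] [DecidableEq α]
    (r : α → α → Prop) [DecidableRel r] (d : ℕ)
    (hd : ∀ x, (Finset.univ.filter (r x)).card = d) (n : ℕ) :
    ∃ s : Finset (List α), (∀ l, l ∈ s ↔ l.IsChain r ∧ l.length ≤ n) ∧
      s.card = Fintype.card α * (∑ i ∈ Finset.range n, d ^ i) + 1 := by
  cases n with
  | zero =>
    refine ⟨{[]}, fun l => ?_, by simp⟩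
    cases l <;> simp
  | succ n =>
    choose f hf hcard using List.exists_finset_isChain_cons_length_le r d hd n
    refine ⟨insert [] (Finset.univ.disjiUnion
      (fun y => (f y).map ⟨List.cons y, List.cons_injective⟩)
      (List.pairwiseDisjoint_map_cons _ f)), fun l => ?_, ?_⟩
    · cases l with
      | nil => simp
      | cons y l => simp [hf]
    · rw [Finset.card_insert_of_notMem (by simp), Finset.card_disjiUnion]
      simp only [Finset.card_map, hcard, Finset.sum_const, Finset.card_univ, smul_eq_mul]

namespace FreeGroup

theorem card_filter_reduced_pair {α : Type*} [Fintype α] [DecidableEq α] (x : α × Bool) :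
    (Finset.univ.filter fun y : α × Bool => x.1 = y.1 → x.2 = y.2).card =
      2 * Fintype.card α - 1 := by
  have : (Finset.univ.filter fun y : α × Bool => x.1 = y.1 → x.2 = y.2) =
      Finset.univ.erase (x.1, !x.2) := by
    ext ⟨a, b⟩
    obtain ⟨c, e⟩ := x
    cases b <;> cases e <;> simp [@eq_comm _ a c]
  rw [this, Finset.card_erase_of_mem (Finset.mem_univ _)]
  simp [mul_comm]

/-- The closed ball of radius `n` in a free group of finite rank. -/
theorem finite_norm_le_and_card {α : Type*} [Fintype α] [DecidableEq α] (n : ℕ) :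
    {g : FreeGroup α | g.norm ≤ n}.Finite ∧
      Nat.card {g : FreeGroup α | g.norm ≤ n} =
        2 * Fintype.card α * (∑ i ∈ Finset.range n, (2 * Fintype.card α - 1) ^ i) + 1 := by
  obtain ⟨s, hs, hcard⟩ := List.exists_finset_isChain_length_le
    (fun x y : α × Bool => x.1 = y.1 → x.2 = y.2) _ card_filter_reduced_pair n
  have himage : toWord '' {g : FreeGroup α | g.norm ≤ n} = (s : Set (List (α × Bool))) := by
    ext l
    simp only [Set.mem_image, Set.mem_ofPred_eq, Finset.mem_coe, hs]
    constructor
    · rintro ⟨g, hg, rfl⟩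
      exact ⟨isReduced_toWord, hg⟩
    · rintro ⟨hl, hn⟩
      have hw : (mk l).toWord = l := IsReduced.reduce_eq hl
      exact ⟨mk l, by rwa [norm, hw], hw⟩
  refine ⟨Set.Finite.of_finite_image (himage ▸ s.finite_toSet) toWord_injective.injOn, ?_⟩
  rw [Nat.card_coe_set_eq, ← Set.ncard_image_of_injective _ toWord_injective, himage,
    Set.ncard_coe_finset, hcard, Fintype.card_prod, Fintype.card_bool, mul_comm 2]

theorem norm_mul_of_isReduced {α : Type*} [DecidableEq α] {x y : FreeGroup α}
    (h : IsReduced (x.toWord ++ y.toWord)) : (x * y).norm = x.norm + y.norm := by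
  rw [norm, toWord_mul, h.reduce_eq, List.length_append, norm, norm]

/-- If no cancellation occurs in `a * b`, then cancellation cannot occur in both `a * g` and
`b⁻¹ * g`. -/
theorem norm_mul_eq_or_norm_inv_mul_eq {α : Type*} [DecidableEq α] {a b : FreeGroup α}
    (hab : IsReduced (a.toWord ++ b.toWord)) (ha : a ≠ 1) (hb : b ≠ 1) (g : FreeGroup α) :
    (a * g).norm = a.norm + g.norm ∨ (b⁻¹ * g).norm = b.norm + g.norm := by
  suffices IsReduced (a.toWord ++ g.toWord) ∨ IsReduced (b⁻¹.toWord ++ g.toWord) from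
    this.imp norm_mul_of_isReduced fun h => by rw [norm_mul_of_isReduced h, norm_inv_eq]
  have hra : IsReduced a.toWord := isReduced_toWord
  have hrb : IsReduced b⁻¹.toWord := isReduced_toWord
  have hrg : IsReduced g.toWord := isReduced_toWord
  rw [ne_eq, ← toWord_eq_nil_iff] at ha hb
  rw [toWord_inv] at hrb ⊢
  obtain ⟨A, x, hA⟩ := (List.eq_nil_or_concat' a.toWord).resolve_left ha
  obtain ⟨z, B, hB⟩ := List.exists_cons_of_ne_nil hb
  rw [hA, hB] at hab
  rw [hA] at hra ⊢
  rw [hB] at hrb ⊢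
  cases hG : g.toWord with
  | nil => left; simpa using hra
  | cons y G =>
    rw [hG] at hrg
    unfold IsReduced at *
    rw [List.isChain_append] at hab ⊢
    rw [List.isChain_append (l₁ := invRev _)]
    simp only [hra, hrb, hrg, true_and]
    have h := hab.2.2
    simp [invRev] at h ⊢
    obtain ⟨x₁, x₂⟩ := x
    obtain ⟨y₁, y₂⟩ := y
    obtain ⟨z₁, z₂⟩ := z
    cases x₂ <;> cases y₂ <;> cases z₂ <;> simp_all <;> grind

/-- The intersection of the balls of radius `n` about `1` and `(a * b)⁻¹` is a ball about the
midpoint `b⁻¹`. -/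
theorem norm_le_and_norm_mul_le_iff {α : Type*} [DecidableEq α] {a b : FreeGroup α} {m n : ℕ}
    (hab : IsReduced (a.toWord ++ b.toWord)) (ha : a.norm = m) (hb : b.norm = m) (hmn : m ≤ n)
    (g : FreeGroup α) :
    (b⁻¹ * g).norm ≤ n ∧ (a * g).norm ≤ n ↔ g.norm ≤ n - m := by
  have hag := norm_mul_le a g
  have hbg := norm_mul_le b⁻¹ g
  rw [norm_inv_eq] at hbg
  rcases Nat.eq_zero_or_pos m with rfl | hm
  · obtain rfl := norm_eq_zero.mp ha
    obtain rfl := norm_eq_zero.mp hb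
    simp
  · have ha' : a ≠ 1 := by rintro rfl; simp at ha; omega
    have hb' : b ≠ 1 := by rintro rfl; simp at hb; omega
    rcases norm_mul_eq_or_norm_inv_mul_eq hab ha' hb' g with h | h <;> omega

/-- An element of norm `2 * m` is a product without cancellation of two elements of norm `m`. -/
theorem exists_mul_eq_of_norm_eq_two_mul {α : Type*} [DecidableEq α] {t : FreeGroup α} {m : ℕ}
    (ht : t.norm = 2 * m) :
    ∃ a b : FreeGroup α, a * b = t ∧ IsReduced (a.toWord ++ b.toWord) ∧
      a.norm = m ∧ b.norm = m := by
  have hred : IsReduced t.toWord := isReduced_toWord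
  have hlen : t.toWord.length = 2 * m := ht
  have hA : (mk (t.toWord.take m)).toWord = t.toWord.take m :=
    IsReduced.reduce_eq (List.IsChain.take hred m)
  have hB : (mk (t.toWord.drop m)).toWord = t.toWord.drop m :=
    IsReduced.reduce_eq (List.IsChain.drop hred m)
  refine ⟨mk (t.toWord.take m), mk (t.toWord.drop m), ?_, ?_, ?_, ?_⟩
  · rw [mul_mk, List.take_append_drop, mk_toWord]
  · rwa [hA, hB, List.take_append_drop]
  · rw [norm, hA, List.length_take]; omega
  · rw [norm, hB, List.length_drop]; omega

end FreeGroup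

/-- in the free group on `k ≥ 2` generators, with `q := 2k − 1`, for `t`
of even word length `2m` and `n ≥ 4m`, the set
`T_n(t) = {h : ℓ(h) ≤ n ∧ ℓ(t·h) ≤ n}` is finite and
`(q − 1)·|T_n(t)| = q^{n−m+1} + q^{n−m} − 2`. -/
theorem card_T_freeGroup_even (k : ℕ) (hk : 2 ≤ k) (q : ℕ) (hq : q = 2 * k - 1)
    (t : FreeGroup (Fin k)) (m : ℕ) (ht : t.norm = 2 * m) (n : ℕ) (hn : 4 * m ≤ n) :
    {h : FreeGroup (Fin k) | h.norm ≤ n ∧ (t * h).norm ≤ n}.Finite ∧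
      (q - 1) * Nat.card {h : FreeGroup (Fin k) | h.norm ≤ n ∧ (t * h).norm ≤ n} =
        q ^ (n - m + 1) + q ^ (n - m) - 2 := by
  obtain ⟨a, b, rfl, hab, ha, hb⟩ := FreeGroup.exists_mul_eq_of_norm_eq_two_mul ht
  obtain ⟨hfin, hcard⟩ := FreeGroup.finite_norm_le_and_card (α := Fin k) (n - m)
  have himage : {h : FreeGroup (Fin k) | h.norm ≤ n ∧ (a * b * h).norm ≤ n} =
      (b⁻¹ * ·) '' {g : FreeGroup (Fin k) | g.norm ≤ n - m} := by
    ext h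
    have := FreeGroup.norm_le_and_norm_mul_le_iff hab ha hb (by omega : m ≤ n) (b * h)
    rw [inv_mul_cancel_left, ← mul_assoc] at this
    simpa using this
  rw [himage]
  refine ⟨hfin.image _, ?_⟩
  rw [Nat.card_image_of_injective (mul_right_injective _), hcard, Fintype.card_fin, ← hq]
  have hgeom : (q - 1) * ∑ i ∈ Finset.range (n - m), q ^ i + 1 = q ^ (n - m) := by
    have := Nat.geomSum_eq (by omega : 2 ≤ q) (n - m)
    have hdvd := Nat.sub_one_dvd_pow_sub_one q (n - m)
    have hpos : 0 < q ^ (n - m) := Nat.pow_pos (by omega)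
    rw [this, Nat.mul_div_cancel' hdvd]
    omega
  obtain ⟨p, rfl⟩ : ∃ p, q = p + 1 := ⟨q - 1, by omega⟩
  rw [show 2 * k = p + 2 by omega, pow_succ, ← hgeom, Nat.add_sub_cancel]
  generalize ∑ i ∈ Finset.range (n - m), (p + 1) ^ i = S
  symm
  apply Nat.sub_eq_of_eq_add
  ring
end

section
/- Let k ≥ 2, let F_k be the free group on k generators, and set q := 2k − 1. Let t ∈ F_k have odd word length ℓ(t) = 2m + 1 for some m ∈ ℕ, and let n ≥ 2(2m+1). Then the set T_n(t) := {h ∈ F_k : ℓ(h) ≤ n and ℓ(t·h) ≤ n} is finite and satisfies (q − 1) · |T_n(t)| = 2·q^{n−m} − 2. -/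
namespace FreeGroup

variable {α : Type*}

/-- The inverse of a letter. -/
def invLetter (a : α × Bool) : α × Bool := (a.1, !a.2)

theorem isReduced_cons_cons_iff_ne_invLetter {a b : α × Bool} {L : List (α × Bool)} :
    IsReduced (a :: b :: L) ↔ b ≠ invLetter a ∧ IsReduced (b :: L) := by
  obtain ⟨a, x⟩ := a
  obtain ⟨b, y⟩ := b
  simp only [IsReduced, List.isChain_cons_cons, invLetter, ne_eq, Prod.mk.injEq]
  cases x <;> cases y <;> simp [eq_comm]

theorem mk_invLetter_singleton (a : α × Bool) : mk [invLetter a] = (mk [a])⁻¹ := by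
  simp [inv_mk, invRev, invLetter]

theorem IsReduced.cons_or_exists_eq_cons {L : List (α × Bool)} (hL : IsReduced L)
    (a : α × Bool) :
    IsReduced (a :: L) ∨ ∃ L', IsReduced (invLetter a :: L') ∧ L = invLetter a :: L' := by
  cases L with
  | nil => exact .inl .singleton
  | cons b L =>
    by_cases hb : b = invLetter a
    · subst hb
      exact .inr ⟨L, hL, rfl⟩
    · exact .inl (isReduced_cons_cons_iff_ne_invLetter.2 ⟨hb, hL⟩)

theorem IsReduced.append_cons {U V W : List (α × Bool)} {a : α × Bool}
    (hU : IsReduced (U ++ a :: V)) (hW : IsReduced (a :: W)) : IsReduced (U ++ a :: W) := by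
  simp only [IsReduced] at *
  rw [List.isChain_split] at hU ⊢
  exact ⟨hU.1, hW⟩

variable [DecidableEq α]

theorem IsReduced.norm_mk {L : List (α × Bool)} (hL : IsReduced L) :
    (mk L).norm = L.length := by
  rw [norm, toWord_mk, hL.reduce_eq]

theorem IsReduced.mk_inj {L M : List (α × Bool)} (hL : IsReduced L) (hM : IsReduced M) :
    mk L = mk M ↔ L = M := by
  rw [← toWord_inj, toWord_mk, toWord_mk, hL.reduce_eq, hM.reduce_eq]

/-- If `a :: L` is reduced, the words `L` lie on the side of the edge `a` away from the far
endpoint, and that endpoint alone controls membership in the intersection of the two balls. -/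
theorem norm_le_and_norm_mul_le_iff_s13 {U V L : List (α × Bool)} {a : α × Bool} {n : ℕ}
    (hUV : V.length ≤ U.length) (ht : IsReduced (U ++ a :: V)) (hL : IsReduced (a :: L)) :
    (((mk V)⁻¹ * mk L).norm ≤ n ∧ (mk (U ++ a :: V) * ((mk V)⁻¹ * mk L)).norm ≤ n) ↔
      L.length < n - U.length := by
  have hmul : mk (U ++ a :: V) * ((mk V)⁻¹ * mk L) = mk (U ++ a :: L) := by
    rw [show U ++ a :: V = U ++ [a] ++ V by simp, show U ++ a :: L = U ++ [a] ++ L by simp,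
      ← mul_mk, ← mul_mk (L₂ := L)]
    group
  have hnorm := (ht.append_cons hL).norm_mk
  have h₁ := norm_mul_le (mk V)⁻¹ (mk L)
  have h₂ : (mk V).norm ≤ V.length := norm_mk_le
  have h₃ : (mk L).norm ≤ L.length := norm_mk_le
  rw [norm_inv_eq] at h₁
  rw [hmul, hnorm, List.length_append, List.length_cons]
  omega

variable [Fintype α]

/-- The words `L` of length less than `r` such that `a :: L` is reduced. -/
def wordsAfter : ℕ → α × Bool → Finset (List (α × Bool))
  | 0, _ => ∅
  | r + 1, a => insert [] ((Finset.univ.erase (invLetter a)).biUnion fun b =>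
      (wordsAfter r b).image (List.cons b))

theorem mem_wordsAfter {r : ℕ} {a : α × Bool} {L : List (α × Bool)} :
    L ∈ wordsAfter r a ↔ IsReduced (a :: L) ∧ L.length < r := by
  induction r generalizing a L with
  | zero => simp [wordsAfter]
  | succ r ih =>
    cases L with
    | nil => simp [wordsAfter]
    | cons b L =>
      rw [isReduced_cons_cons_iff_ne_invLetter]
      simp only [wordsAfter, Finset.mem_insert, reduceCtorEq, false_or, Finset.mem_biUnion,
        Finset.mem_erase, Finset.mem_univ, and_true, Finset.mem_image, List.cons.injEq, ih,
        List.length_cons, Nat.add_lt_add_iff_right]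
      constructor
      · rintro ⟨_, hb, _, hL, rfl, rfl⟩
        exact ⟨⟨hb, hL.1⟩, hL.2⟩
      · rintro ⟨⟨hb, hL⟩, hlt⟩
        exact ⟨b, hb, L, ⟨hL, hlt⟩, rfl, rfl⟩

theorem card_wordsAfter_succ (r : ℕ) (a : α × Bool) :
    (wordsAfter (r + 1) a).card =
      1 + ∑ b ∈ Finset.univ.erase (invLetter a), (wordsAfter r b).card := by
  rw [wordsAfter, Finset.card_insert_of_notMem (by simp), Finset.card_biUnion, add_comm]
  · exact congrArg _ (Finset.sum_congr rfl fun b _ =>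
      Finset.card_image_of_injective _ List.cons_injective)
  · intro b _ c _ hbc
    simp only [Finset.disjoint_left, Finset.mem_image]
    rintro _ ⟨L, -, rfl⟩ ⟨M, -, h⟩
    exact hbc (List.cons.inj h).1.symm

theorem card_wordsAfter (r : ℕ) (a : α × Bool) :
    (2 * Fintype.card α - 2) * (wordsAfter r a).card + 1 = (2 * Fintype.card α - 1) ^ r := by
  have hpos : 0 < Fintype.card α := Fintype.card_pos_iff.2 ⟨a.1⟩
  obtain ⟨p, hp⟩ : ∃ p, Fintype.card α = p + 1 := ⟨_, (Nat.succ_pred_eq_of_pos hpos).symm⟩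
  have h₁ : 2 * Fintype.card α - 2 = 2 * p := by omega
  have h₂ : 2 * Fintype.card α - 1 = 2 * p + 1 := by omega
  rw [h₁, h₂]
  induction r generalizing a with
  | zero => simp [wordsAfter]
  | succ r ih =>
    have hcard : (Finset.univ.erase (invLetter a)).card = 2 * p + 1 := by
      rw [Finset.card_erase_of_mem (Finset.mem_univ _), Finset.card_univ, Fintype.card_prod,
        Fintype.card_bool]
      omega
    calc 2 * p * (wordsAfter (r + 1) a).card + 1
        = ∑ b ∈ Finset.univ.erase (invLetter a), (2 * p * (wordsAfter r b).card + 1) := by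
          rw [card_wordsAfter_succ, Finset.sum_add_distrib, ← Finset.mul_sum, Finset.sum_const,
            hcard, smul_eq_mul]
          ring
      _ = (2 * p + 1) ^ (r + 1) := by
          rw [Finset.sum_congr rfl fun b _ => ih b, Finset.sum_const, hcard, smul_eq_mul]
          ring

/-- The intersection of two balls of radius `n` around `1` and `(mk (U ++ a :: V))⁻¹`, cut
along the middle edge of the geodesic joining the centers. -/
def ballInter (n : ℕ) (U V : List (α × Bool)) (a : α × Bool) : Finset (FreeGroup α) :=
  (wordsAfter (n - U.length) a).image (fun L => (mk V)⁻¹ * mk L) ∪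
    (wordsAfter (n - U.length) (invLetter a)).image fun L => (mk V)⁻¹ * mk (invLetter a :: L)

theorem mem_ballInter {n : ℕ} {U V : List (α × Bool)} {a : α × Bool}
    (hUV : U.length = V.length) (ht : IsReduced (U ++ a :: V)) {h : FreeGroup α} :
    h ∈ ballInter n U V a ↔ h.norm ≤ n ∧ (mk (U ++ a :: V) * h).norm ≤ n := by
  have near {L} (hL : IsReduced (a :: L)) := norm_le_and_norm_mul_le_iff_s13 (n := n) hUV.ge ht hL
  have far {L} (hL : IsReduced (invLetter a :: L)) :
      (((mk V)⁻¹ * mk (invLetter a :: L)).norm ≤ n ∧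
        (mk (U ++ a :: V) * ((mk V)⁻¹ * mk (invLetter a :: L))).norm ≤ n) ↔
      L.length < n - U.length := by
    have hinv : invRev (U ++ a :: V) = invRev V ++ invLetter a :: invRev U := by
      simp [invRev, invLetter]
    have hred : IsReduced (invRev V ++ invLetter a :: invRev U) := by
      rw [← hinv, isReduced_iff_reduce_eq, reduce_invRev, ht.reduce_eq]
    have key := norm_le_and_norm_mul_le_iff_s13 (n := n) (by simp [hUV]) hred hL
    rw [← hinv, ← inv_mk, ← inv_mk, inv_inv, invRev_length, ← hUV] at key
    have hcons : mk (invLetter a :: L) = (mk [a])⁻¹ * mk L := by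
      rw [← mk_invLetter_singleton, mul_mk, List.singleton_append]
    have hsplit : mk (U ++ a :: V) = mk U * mk [a] * mk V := by simp [mul_mk]
    have hfst : (mk (U ++ a :: V))⁻¹ * (mk U * mk L) =
        (mk V)⁻¹ * mk (invLetter a :: L) := by
      rw [hcons, hsplit]
      group
    have hsnd : mk (U ++ a :: V) * ((mk V)⁻¹ * mk (invLetter a :: L)) = mk U * mk L := by
      rw [← hfst, mul_inv_cancel_left]
    rw [← key, hsnd, hfst, and_comm]
  simp only [ballInter, Finset.mem_union, Finset.mem_image, mem_wordsAfter]
  constructor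
  · rintro (⟨L, ⟨hL, hlt⟩, rfl⟩ | ⟨L, ⟨hL, hlt⟩, rfl⟩)
    · exact (near hL).2 hlt
    · exact (far hL).2 hlt
  · intro hh
    have heq : h = (mk V)⁻¹ * mk (mk V * h).toWord := by rw [mk_toWord, inv_mul_cancel_left]
    rcases (isReduced_toWord (x := mk V * h)).cons_or_exists_eq_cons a with hL | ⟨L, hL, hL'⟩
    · rw [heq] at hh
      exact .inl ⟨_, ⟨hL, (near hL).1 hh⟩, heq.symm⟩
    · rw [hL'] at heq
      rw [heq] at hh
      exact .inr ⟨_, ⟨hL, (far hL).1 hh⟩, heq.symm⟩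

theorem card_ballInter (n : ℕ) (U V : List (α × Bool)) (a : α × Bool) :
    (ballInter n U V a).card = (wordsAfter (n - U.length) a).card +
      (wordsAfter (n - U.length) (invLetter a)).card := by
  rw [ballInter, Finset.card_union_of_disjoint, Finset.card_image_of_injOn,
    Finset.card_image_of_injOn]
  · intro L hL M hM h
    rw [Finset.mem_coe, mem_wordsAfter] at hL hM
    exact (List.cons.inj ((hL.1.mk_inj hM.1).1 (mul_left_cancel h))).2
  · intro L hL M hM h
    rw [Finset.mem_coe, mem_wordsAfter] at hL hM
    exact (IsReduced.mk_inj hL.1.tail hM.1.tail).1 (mul_left_cancel h)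
  · simp only [Finset.disjoint_left, Finset.mem_image, mem_wordsAfter]
    rintro _ ⟨L, ⟨hL, -⟩, rfl⟩ ⟨M, ⟨hM, -⟩, h⟩
    obtain rfl := (hM.mk_inj (List.IsChain.tail hL)).1 (mul_left_cancel h)
    exact (isReduced_cons_cons_iff_ne_invLetter.1 hL).1 rfl

end FreeGroup


/-- in the free group on `k ≥ 2` generators, with `q := 2k − 1`, for `t`
of odd word length `2m + 1` and `n ≥ 2(2m+1)`, the set
`T_n(t) = {h : ℓ(h) ≤ n ∧ ℓ(t·h) ≤ n}` is finite and
`(q − 1)·|T_n(t)| = 2·q^{n−m} − 2`. -/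
theorem card_T_freeGroup_odd (k : ℕ) (hk : 2 ≤ k) (q : ℕ) (hq : q = 2 * k - 1)
    (t : FreeGroup (Fin k)) (m : ℕ) (ht : t.norm = 2 * m + 1) (n : ℕ)
    (hn : 2 * (2 * m + 1) ≤ n) :
    {h : FreeGroup (Fin k) | h.norm ≤ n ∧ (t * h).norm ≤ n}.Finite ∧
      (q - 1) * Nat.card {h : FreeGroup (Fin k) | h.norm ≤ n ∧ (t * h).norm ≤ n} =
        2 * q ^ (n - m) - 2 := by
  obtain ⟨U, a, V, hU, hV, hw⟩ : ∃ U a V, U.length = m ∧ V.length = m ∧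
      t.toWord = U ++ a :: V := by
    have hlen : t.toWord.length = 2 * m + 1 := ht
    refine ⟨t.toWord.take m, t.toWord[m], t.toWord.drop (m + 1), ?_, ?_, ?_⟩
    · rw [List.length_take]
      omega
    · rw [List.length_drop]
      omega
    · rw [List.getElem_cons_drop, List.take_append_drop]
  have hred : FreeGroup.IsReduced (U ++ a :: V) := hw ▸ FreeGroup.isReduced_toWord
  have hset : {h : FreeGroup (Fin k) | h.norm ≤ n ∧ (t * h).norm ≤ n} =
      FreeGroup.ballInter n U V a := by
    ext h
    rw [Finset.mem_coe, FreeGroup.mem_ballInter (hU.trans hV.symm) hred, ← hw,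
      FreeGroup.mk_toWord, Set.mem_ofPred_eq]
  have h₁ := FreeGroup.card_wordsAfter (n - m) a
  have h₂ := FreeGroup.card_wordsAfter (n - m) (FreeGroup.invLetter a)
  rw [Fintype.card_fin, ← hq, show 2 * k - 2 = q - 1 by omega] at h₁ h₂
  rw [hset]
  refine ⟨Finset.finite_toSet _, ?_⟩
  rw [Nat.card_coe_set_eq, Set.ncard_coe_finset, FreeGroup.card_ballInter, hU, mul_add]
  omega
end

section
/- Let k ≥ 2, let F_k be the free group on k generators, and let t ∈ F_k have odd word length ℓ(t) = 2m + 1 for some m ∈ ℕ. Then the sequence of real numbers |T_n(t)| / |B_n|, where T_n(t) := {h ∈ F_k : ℓ(h) ≤ n and ℓ(t·h) ≤ n} and B_n := {h ∈ F_k : ℓ(h) ≤ n}, converges to 1 / (k·(2k−1)^m) as n → ∞. -/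
namespace FreeGroup

variable {α : Type*} [DecidableEq α]

/-- The word length of a product whose concatenated words are reduced. -/
theorem norm_mk_mul_of_isReduced {L : List (α × Bool)} {g : FreeGroup α}
    (h : IsReduced (L ++ g.toWord)) : (mk L * g).norm = L.length + g.norm := by
  have hL : reduce L = L := (h.infix ⟨[], g.toWord, by simp⟩).reduce_eq
  rw [norm, toWord_mul, toWord_mk, hL, h.reduce_eq, List.length_append, norm]

/-- Left multiplication by a letter lengthens every word that does not begin with its inverse. -/
theorem norm_letter_mul {x : α × Bool} {g : FreeGroup α}
    (h : g.toWord.head? ≠ some (x.1, !x.2)) : (mk [x] * g).norm = g.norm + 1 := by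
  rw [norm_mk_mul_of_isReduced, List.length_singleton, add_comm]
  have hg := isReduced_toWord (x := g)
  cases hw : g.toWord with
  | nil => simp
  | cons y l =>
    rw [hw] at h hg
    obtain ⟨a, b⟩ := x
    obtain ⟨c, d⟩ := y
    refine isReduced_cons_cons.2 ⟨?_, hg⟩
    rintro rfl
    cases b <;> cases d <;> simp_all

/-- Left multiplication by a letter shortens every word that begins with its inverse. -/
theorem norm_letter_mul_of_head? {x : α × Bool} {g : FreeGroup α}
    (h : g.toWord.head? = some (x.1, !x.2)) : (mk [x] * g).norm + 1 = g.norm := by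
  obtain ⟨l, hl⟩ : ∃ l, g.toWord = (x.1, !x.2) :: l := by
    cases hw : g.toWord with
    | nil => simp [hw] at h
    | cons y l => simp_all
  have hr := isReduced_toWord (x := g)
  rw [hl] at hr
  have hlr : IsReduced l := hr.infix ⟨[(x.1, !x.2)], [], by simp⟩
  have : mk [x] * g = mk l := by
    conv_lhs => rw [← mk_toWord (x := g), hl, mul_mk]
    exact Quot.sound (Red.Step.not (L₁ := []) (x := x.1) (b := x.2))
  rw [this, norm, toWord_mk, hlr.reduce_eq, norm, hl, List.length_cons]

/-- If `x :: L ++ [y]` is reduced and `g` begins with `y`, then nothing cancels in `x * L * g`. -/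
theorem norm_mul_of_head? {x y : α × Bool} {L : List (α × Bool)} {g : FreeGroup α}
    (hr : IsReduced (x :: (L ++ [y]))) (hg : g.toWord.head? = some y) :
    (mk L * g).norm = L.length + g.norm ∧
      (mk [x] * (mk L * g)).norm = L.length + g.norm + 1 := by
  obtain ⟨l, hl⟩ : ∃ l, g.toWord = y :: l := by
    cases hw : g.toWord with
    | nil => simp [hw] at hg
    | cons z l => simp_all
  have h : IsReduced (x :: (L ++ g.toWord)) := by
    have := IsReduced.append_overlap (L₁ := x :: L) (L₂ := [y]) (L₃ := l) (by simpa using hr)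
      (by simpa [hl] using isReduced_toWord (x := g)) (by simp)
    simpa [hl] using this
  refine ⟨norm_mk_mul_of_isReduced (h.infix ⟨[x], [], by simp⟩), ?_⟩
  rw [← mul_assoc, mul_mk, norm_mk_mul_of_isReduced (by simpa using h)]
  simp
  omega

theorem isReduced_invRev {L : List (α × Bool)} (h : IsReduced L) : IsReduced (invRev L) := by
  rw [isReduced_iff_reduce_eq, reduce_invRev, h.reduce_eq]

/-- Removing the first and last letter of `t` (and translating) decreases the radius by one. -/
theorem norm_le_iff_of_isReduced {x y : α × Bool} {L : List (α × Bool)}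
    (hr : IsReduced (x :: (L ++ [y]))) (g : FreeGroup α) (n : ℕ) :
    ((mk [(y.1, !y.2)] * g).norm ≤ n + 1 ∧ (mk [x] * (mk L * g)).norm ≤ n + 1) ↔
      g.norm ≤ n ∧ (mk L * g).norm ≤ n := by
  constructor
  · rintro ⟨h₁, h₂⟩
    by_cases hy : g.toWord.head? = some y
    · have := norm_mul_of_head? hr hy
      omega
    have e₁ : (mk [(y.1, !y.2)] * g).norm = g.norm + 1 := norm_letter_mul (by simpa using hy)
    by_cases hx : (mk L * g).toWord.head? = some (x.1, !x.2)
    · have hr' : IsReduced ((y.1, !y.2) :: (invRev L ++ [(x.1, !x.2)])) := by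
        simpa [invRev] using isReduced_invRev hr
      have := norm_mul_of_head? hr' hx
      rw [← inv_mk, inv_mul_cancel_left] at this
      omega
    · have := norm_letter_mul hx
      omega
  · rintro ⟨h₁, h₂⟩
    have e₁ := norm_mul_le (mk [(y.1, !y.2)]) g
    have e₂ := norm_mul_le (mk [x]) (mk L * g)
    have l₁ := norm_mk_le (L₁ := [(y.1, !y.2)])
    have l₂ := norm_mk_le (L₁ := [x])
    simp only [List.length_singleton] at l₁ l₂
    omega

theorem natCard_eq_card_of_toWord {P : FreeGroup α → Prop} {s : Finset (List (α × Bool))}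
    (hs : ∀ l ∈ s, IsReduced l) (hP : ∀ g : FreeGroup α, P g ↔ g.toWord ∈ s) :
    Nat.card {g | P g} = s.card := by
  rw [Nat.card_coe_set_eq, ← Set.ncard_image_of_injective _ toWord_injective,
    ← Set.ncard_coe_finset]
  congr 1
  ext l
  simp only [Set.mem_image, Set.mem_ofPred_eq, hP, Finset.mem_coe]
  constructor
  · rintro ⟨g, hg, rfl⟩
    exact hg
  · intro hl
    have : (mk l).toWord = l := by rw [toWord_mk, (hs l hl).reduce_eq]
    exact ⟨mk l, by rwa [this], this⟩

variable [Fintype α]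

/-- The reduced words of length `n + 1` with a prescribed first letter. -/
def reducedWordsFrom : ℕ → α × Bool → Finset (List (α × Bool))
  | 0, x => {[x]}
  | n + 1, x => (({(x.1, !x.2)}ᶜ : Finset (α × Bool)).biUnion (reducedWordsFrom n)).image (x :: ·)

/-- The reduced words of length at most `n`. -/
def reducedWordsLE : ℕ → Finset (List (α × Bool))
  | 0 => {[]}
  | n + 1 => reducedWordsLE n ∪ Finset.univ.biUnion (reducedWordsFrom n)

theorem mem_reducedWordsFrom {n : ℕ} {x : α × Bool} {l : List (α × Bool)} :
    l ∈ reducedWordsFrom n x ↔ IsReduced l ∧ l.length = n + 1 ∧ l.head? = some x := by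
  induction n generalizing x l with
  | zero =>
    rcases l with _ | ⟨a, _ | ⟨b, l⟩⟩ <;> simp [reducedWordsFrom]
  | succ n ih =>
    have key : ∀ a b : α × Bool, b ≠ (a.1, !a.2) ↔ (a.1 = b.1 → a.2 = b.2) := by
      rintro ⟨a, c⟩ ⟨b, d⟩
      by_cases h : a = b <;> cases c <;> cases d <;> simp [h, eq_comm]
    rcases l with _ | ⟨a, _ | ⟨b, l⟩⟩
    · simp [reducedWordsFrom]
    · simp [reducedWordsFrom, ih]
    · simp only [reducedWordsFrom, Finset.mem_image, Finset.mem_biUnion, Finset.mem_compl,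
        Finset.mem_singleton, ih, List.cons.injEq, isReduced_cons_cons, List.length_cons,
        List.head?_cons, Option.some.injEq]
      constructor
      · rintro ⟨_, ⟨c, hc, h₁, h₂, h₃⟩, rfl, rfl⟩
        simp only [List.head?_cons, Option.some.injEq] at h₃
        subst h₃
        exact ⟨⟨(key _ _).1 hc, h₁⟩, by simpa using h₂, rfl⟩
      · rintro ⟨⟨h₁, h₂⟩, h₃, rfl⟩
        exact ⟨_, ⟨b, (key _ _).2 h₁, h₂, by simpa using h₃, rfl⟩, rfl, rfl⟩

theorem mem_reducedWordsLE {n : ℕ} {l : List (α × Bool)} :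
    l ∈ reducedWordsLE n ↔ IsReduced l ∧ l.length ≤ n := by
  induction n with
  | zero =>
    rcases l with _ | ⟨a, l⟩ <;> simp [reducedWordsLE]
  | succ n ih =>
    rcases l with _ | ⟨a, l⟩
    · simp [reducedWordsLE, ih]
    · simp only [reducedWordsLE, Finset.mem_union, ih, Finset.mem_biUnion, Finset.mem_univ,
        true_and, mem_reducedWordsFrom, List.head?_cons, List.length_cons, Option.some.injEq,
        exists_and_left, exists_eq', and_true, ← and_or_left]
      exact and_congr_right fun _ => by omega

theorem pairwiseDisjoint_reducedWordsFrom (n : ℕ) (s : Set (α × Bool)) :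
    s.PairwiseDisjoint (reducedWordsFrom n) := by
  intro x _ y _ hxy
  refine Finset.disjoint_left.2 fun l hx hy => hxy ?_
  rw [mem_reducedWordsFrom] at hx hy
  exact Option.some.inj (hx.2.2.symm.trans hy.2.2)

theorem card_reducedWordsFrom {q : ℕ} (hq : 2 * Fintype.card α = q + 1) (n : ℕ) (x : α × Bool) :
    (reducedWordsFrom n x).card = q ^ n := by
  induction n generalizing x with
  | zero => simp [reducedWordsFrom]
  | succ n ih =>
    rw [reducedWordsFrom, Finset.card_image_of_injective _ (List.cons_injective),
      Finset.card_biUnion (pairwiseDisjoint_reducedWordsFrom n _), Finset.sum_congr rfl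
      fun y _ => ih y, Finset.sum_const, Finset.card_compl, Finset.card_singleton,
      Fintype.card_prod, Fintype.card_bool, mul_comm _ 2, hq, Nat.add_sub_cancel, smul_eq_mul,
      pow_succ']

theorem card_reducedWordsLE_succ {q : ℕ} (hq : 2 * Fintype.card α = q + 1) (n : ℕ) :
    (reducedWordsLE (α := α) (n + 1)).card =
      (reducedWordsLE (α := α) n).card + (q + 1) * q ^ n := by
  rw [reducedWordsLE, Finset.card_union_of_disjoint,
    Finset.card_biUnion (pairwiseDisjoint_reducedWordsFrom n _), Finset.sum_congr rfl
    fun y _ => card_reducedWordsFrom hq n y, Finset.sum_const, Finset.card_univ,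
    Fintype.card_prod, Fintype.card_bool, mul_comm _ 2, hq, smul_eq_mul]
  refine Finset.disjoint_left.2 fun l h₁ h₂ => ?_
  simp only [Finset.mem_biUnion, mem_reducedWordsFrom, mem_reducedWordsLE] at h₁ h₂
  obtain ⟨_, _, _, h, _⟩ := h₂
  omega

theorem card_reducedWordsLE {q : ℕ} (hq : 2 * Fintype.card α = q + 1) (n : ℕ) :
    ((q : ℝ) - 1) * (reducedWordsLE (α := α) n).card = (q + 1) * (q : ℝ) ^ n - 2 := by
  induction n with
  | zero => simp [reducedWordsLE]; ring
  | succ n ih =>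
    rw [card_reducedWordsLE_succ hq]
    push_cast
    rw [mul_add, ih]
    ring

theorem natCard_ball (n : ℕ) :
    Nat.card {h : FreeGroup α | h.norm ≤ n} = (reducedWordsLE (α := α) n).card :=
  natCard_eq_card_of_toWord (fun l hl => (mem_reducedWordsLE.1 hl).1)
    fun g => by simp [mem_reducedWordsLE, isReduced_toWord, norm]

theorem natCard_inter_letter {q : ℕ} (hq : 2 * Fintype.card α = q + 1) (x : α × Bool) (n : ℕ) :
    Nat.card {h : FreeGroup α | h.norm ≤ n + 1 ∧ (mk [x] * h).norm ≤ n + 1} =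
      (reducedWordsLE (α := α) n).card + q ^ n := by
  rw [← card_reducedWordsFrom hq n (x.1, !x.2), ← Finset.card_union_of_disjoint]
  · refine natCard_eq_card_of_toWord (fun l hl => ?_) fun g => ?_
    · rw [Finset.mem_union, mem_reducedWordsLE, mem_reducedWordsFrom] at hl
      exact hl.elim And.left And.left
    · simp only [Finset.mem_union, mem_reducedWordsLE, mem_reducedWordsFrom, isReduced_toWord,
        true_and]
      change g.norm ≤ n + 1 ∧ (mk [x] * g).norm ≤ n + 1 ↔ g.norm ≤ n ∨ g.norm = n + 1 ∧ _
      by_cases h : g.toWord.head? = some (x.1, !x.2)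
      · have := norm_letter_mul_of_head? h
        simp only [h, and_true]
        omega
      · have := norm_letter_mul h
        simp only [h, and_false, or_false]
        omega
  · refine Finset.disjoint_left.2 fun l h₁ h₂ => ?_
    rw [mem_reducedWordsLE] at h₁
    rw [mem_reducedWordsFrom] at h₂
    omega

/-- The number of points in the intersection of two balls of radius `n + m + 1` whose centres
are at distance `2 * m + 1`. -/
theorem natCard_inter_of_norm_odd {q : ℕ} (hq : 2 * Fintype.card α = q + 1) (m n : ℕ)
    (t : FreeGroup α) (ht : t.norm = 2 * m + 1) :
    Nat.card {h : FreeGroup α | h.norm ≤ n + m + 1 ∧ (t * h).norm ≤ n + m + 1} =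
      (reducedWordsLE (α := α) n).card + q ^ n := by
  induction m generalizing t with
  | zero =>
    obtain ⟨x, hx⟩ := List.length_eq_one_iff.1 ht
    rw [← mk_toWord (x := t), hx]
    exact natCard_inter_letter hq x n
  | succ m ih =>
    obtain ⟨x, L, y, hL⟩ : ∃ x L y, t.toWord = x :: (L ++ [y]) := by
      rw [norm] at ht
      rcases hw : t.toWord with _ | ⟨x, l⟩
      · simp [hw] at ht
      · rcases List.eq_nil_or_concat l with rfl | ⟨L, y, rfl⟩
        · simp [hw] at ht
        · exact ⟨x, L, y, by simp⟩
    have hr : IsReduced (x :: (L ++ [y])) := hL ▸ isReduced_toWord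
    have hLr : IsReduced L := hr.infix ⟨[x], [y], by simp⟩
    have hlen : (mk L).norm = 2 * m + 1 := by
      rw [norm, toWord_mk, hLr.reduce_eq]
      rw [norm, hL] at ht
      simp at ht
      omega
    have ht' : t = mk [x] * (mk L * mk [y]) := by
      rw [← mk_toWord (x := t), hL]
      simp
    have hinv : mk [(y.1, !y.2)] = (mk [y])⁻¹ := by simp [inv_mk, invRev]
    rw [← ih (mk L) hlen]
    refine Nat.card_congr ((Equiv.mulLeft (mk [y])).subtypeEquiv fun h => ?_)
    have := norm_le_iff_of_isReduced hr (mk [y] * h) (n + m + 1)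
    rw [hinv, inv_mul_cancel_left] at this
    rw [← mul_assoc (mk L), ← mul_assoc (mk [x]), ← ht', mul_assoc (mk L)] at this
    exact this

end FreeGroup


/-- in the free group on `k ≥ 2` generators, for `t` of odd word length
`2m + 1`, the ratio `|T_n(t)| / |B_n|` converges to `1 / (k·(2k−1)^m)` as `n → ∞`. -/
theorem ratio_T_ball_tendsto_odd (k : ℕ) (hk : 2 ≤ k)
    (t : FreeGroup (Fin k)) (m : ℕ) (ht : t.norm = 2 * m + 1) :
    Filter.Tendsto
      (fun n : ℕ =>
        (Nat.card {h : FreeGroup (Fin k) | h.norm ≤ n ∧ (t * h).norm ≤ n} : ℝ) /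
          (Nat.card {h : FreeGroup (Fin k) | h.norm ≤ n} : ℝ))
      Filter.atTop (nhds (1 / ((k : ℝ) * (2 * (k : ℝ) - 1) ^ m))) := by
  obtain ⟨q, hq⟩ : ∃ q, 2 * Fintype.card (Fin k) = q + 1 := ⟨2 * k - 1, by simp; omega⟩
  have hqk : (2 * k : ℝ) = q + 1 := by simpa using congrArg (Nat.cast (R := ℝ)) hq
  have hk' : (2 : ℝ) ≤ k := by exact_mod_cast hk
  have hq3 : (3 : ℝ) ≤ q := by linarith
  have hq1 : (0 : ℝ) < q - 1 := by linarith
  have hq0 : (0 : ℝ) < q := by linarith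
  rw [← Filter.tendsto_add_atTop_iff_nat (m + 1)]
  have hpow : Filter.Tendsto (fun n : ℕ => ((q : ℝ)⁻¹) ^ n) Filter.atTop (nhds 0) :=
    tendsto_pow_atTop_nhds_zero_of_lt_one (by positivity) (inv_lt_one_of_one_lt₀ (by linarith))
  have hlim : Filter.Tendsto
      (fun n : ℕ => (2 * q - 2 * ((q : ℝ)⁻¹) ^ n) /
        ((q + 1) * (q : ℝ) ^ (m + 1) - 2 * ((q : ℝ)⁻¹) ^ n)) Filter.atTop
      (nhds ((2 * q - 2 * 0) / ((q + 1) * (q : ℝ) ^ (m + 1) - 2 * 0))) :=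
    (tendsto_const_nhds.sub (hpow.const_mul 2)).div (tendsto_const_nhds.sub (hpow.const_mul 2))
      (by simp only [mul_zero, sub_zero]; positivity)
  have hval : (2 * q - 2 * 0) / ((q + 1) * (q : ℝ) ^ (m + 1) - 2 * 0) =
      1 / ((k : ℝ) * (2 * (k : ℝ) - 1) ^ m) := by
    have hk0 : (k : ℝ) ≠ 0 := by linarith
    rw [show 2 * (k : ℝ) - 1 = q by linarith, ← hqk]
    field_simp
    ring
  rw [← hval]
  refine hlim.congr fun n => ?_
  have hT := FreeGroup.natCard_inter_of_norm_odd hq m n t ht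
  have hB := FreeGroup.card_reducedWordsLE hq n
  have hB' := FreeGroup.card_reducedWordsLE hq (n + (m + 1))
  rw [FreeGroup.natCard_ball, ← add_assoc, hT, add_assoc n,
    ← mul_div_mul_left _ (Nat.cast _) hq1.ne', hB', Nat.cast_add, mul_add, hB, Nat.cast_pow,
    ← mul_div_mul_left _ _ (pow_pos hq0 n).ne']
  have hqn : (q : ℝ) ^ n * ((q : ℝ)⁻¹) ^ n = 1 := by
    rw [← mul_pow, mul_inv_cancel₀ hq0.ne', one_pow]
  congr 1
  · linear_combination -2 * hqn
  · rw [pow_add]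
    linear_combination -2 * hqn
end

section
/- Let G be a group and S a finite subset of G with k elements such that 1 ∉ S and S⁻¹ = S. For n ∈ ℕ let B_n := ⋃_{m ≤ n} S^m be the set of products of at most n elements of S (with B_0 = {1}), and for j ≥ 1 let S_j := B_j \ B_{j−1} be the sphere of radius j. Then for every j ≥ 1, |S_{j+1}| ≤ (k − 1) · |S_j|. -/
open scoped Pointwise

/-- `B_n := ⋃_{m ≤ n} S^m`, the ball of radius `n` for the generating set `S`
(`B_0 = {1}`). -/
def ballOf {G : Type*} [Group G] [DecidableEq G] (S : Finset G) (n : ℕ) : Finset G :=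
  (Finset.range (n + 1)).biUnion fun m => S ^ m

section Ball

variable {G : Type*} [Group G] [DecidableEq G] {S : Finset G}

lemma mem_ballOf {n : ℕ} {x : G} : x ∈ ballOf S n ↔ ∃ m ≤ n, x ∈ S ^ m := by
  simp [ballOf]

lemma mul_mem_ballOf_succ {n : ℕ} {x s : G} (hx : x ∈ ballOf S n) (hs : s ∈ S) :
    x * s ∈ ballOf S (n + 1) := by
  obtain ⟨m, hm, hx⟩ := mem_ballOf.1 hx
  exact mem_ballOf.2 ⟨m + 1, by omega, pow_succ S m ▸ Finset.mul_mem_mul hx hs⟩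

/-- An element of the sphere of radius `n + 1` is the product of an element of the ball of
radius `n` and a generator. -/
lemma exists_mul_eq_of_mem_sphere {n : ℕ} {x : G} (hx : x ∈ ballOf S (n + 1) \ ballOf S n) :
    ∃ y ∈ ballOf S n, ∃ s ∈ S, y * s = x := by
  obtain ⟨hx, hx'⟩ := Finset.mem_sdiff.1 hx
  obtain ⟨m, hm, hxm⟩ := mem_ballOf.1 hx
  obtain rfl : m = n + 1 := by
    by_contra h
    exact hx' (mem_ballOf.2 ⟨m, by omega, hxm⟩)
  rw [pow_succ] at hxm
  obtain ⟨y, hy, s, hs, rfl⟩ := Finset.mem_mul.1 hxm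
  exact ⟨y, mem_ballOf.2 ⟨n, le_rfl, hy⟩, s, hs, rfl⟩

/-- A point of a sphere has at most `|S| - 1` neighbours outside the previous ball. -/
lemma card_image_mul_sdiff_ballOf_le (hsymm : S⁻¹ = S) {n : ℕ} {x : G}
    (hx : x ∈ ballOf S (n + 1) \ ballOf S n) :
    (S.image (x * ·) \ ballOf S n).card ≤ S.card - 1 := by
  obtain ⟨y, hy, s, hs, rfl⟩ := exists_mul_eq_of_mem_sphere hx
  have hs' : s⁻¹ ∈ S := hsymm ▸ Finset.inv_mem_inv hs
  rw [← Finset.card_erase_of_mem hs']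
  refine (Finset.card_le_card fun z hz => ?_).trans
    (Finset.card_image_le (f := (y * s * ·)))
  obtain ⟨hz, hzn⟩ := Finset.mem_sdiff.1 hz
  obtain ⟨t, ht, rfl⟩ := Finset.mem_image.1 hz
  refine Finset.mem_image_of_mem _ (Finset.mem_erase.2 ⟨?_, ht⟩)
  rintro rfl
  exact hzn (by simpa using hy)

end Ball

/-- if `S` is a finite symmetric set of `k` elements with `1 ∉ S`, then
the spheres `S_j := B_j \ B_{j−1}` satisfy `|S_{j+1}| ≤ (k−1)·|S_j|` for every `j ≥ 1`. -/
theorem card_sphere_succ_le {G : Type*} [Group G] [DecidableEq G]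
    (S : Finset G) (k : ℕ) (hcard : S.card = k) (hone : (1 : G) ∉ S) (hsymm : S⁻¹ = S)
    (j : ℕ) (hj : 1 ≤ j) :
    (ballOf S (j + 1) \ ballOf S j).card ≤
      (k - 1) * (ballOf S j \ ballOf S (j - 1)).card := by
  obtain ⟨n, rfl⟩ := Nat.exists_eq_add_of_le' hj
  subst hcard
  rw [Nat.add_sub_cancel, mul_comm]
  refine (Finset.card_le_card fun x hx => ?_).trans
    (Finset.card_biUnion_le_card_mul (ballOf S (n + 1) \ ballOf S n)
      (fun x => S.image (x * ·) \ ballOf S n) (S.card - 1)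
      fun x hx => card_image_mul_sdiff_ballOf_le hsymm hx)
  obtain ⟨y, hy, s, hs, rfl⟩ := exists_mul_eq_of_mem_sphere hx
  have hx' := (Finset.mem_sdiff.1 hx).2
  refine Finset.mem_biUnion.2 ⟨y, Finset.mem_sdiff.2 ⟨hy, fun h => ?_⟩,
    Finset.mem_sdiff.2 ⟨Finset.mem_image_of_mem _ hs, fun h => ?_⟩⟩
  · exact hx' (mul_mem_ballOf_succ h hs)
  · obtain ⟨m, hm, h⟩ := mem_ballOf.1 h
    exact hx' (mem_ballOf.2 ⟨m, by omega, h⟩)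
end
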